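/- The field of U-invariants K(M)^U of the adjoint representation of GL(n,K) is a purely transcendental extension of K of transcendence degree n(n+1)/2: the polynomials J_{k,i}, 1 ≤ k ≤ n, 0 ≤ i ≤ k−1, form an algebraically independent family that generates K(M)^U over K as a field. -/

import Mathlib

open Matrix MvPolynomial

/-- `u` is an upper triangular matrix with all diagonal entries equal to `1`
(upper unitriangular matrix). -/
def IsUniUpperTriangular {n : ℕ} {K : Type*} [CommRing K]
    (u : Matrix (Fin n) (Fin n) K) : Prop :=
  (∀ a : Fin n, u a a = 1) ∧ ∀ a b : Fin n, (b : ℕ) < (a : ℕ) → u a b = 0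

/-- The polynomial invariant `J_{k,i}` evaluated at a matrix `A`: the
determinant of the `k × k` matrix whose first `k - i` rows are the last
`k - i` rows of `A` restricted to the first `k` columns, and whose last `i`
rows are the last `i` rows of the adjugate matrix `A*` restricted to the first
`k` columns. -/
def Jki {n : ℕ} {R : Type*} [CommRing R] (k i : ℕ) (hk : k ≤ n) (hik : i < k)
    (A : Matrix (Fin n) (Fin n) R) : R :=
  Matrix.det (Matrix.of fun r c : Fin k =>
    if h : (r : ℕ) < k - i then
      A ⟨n - (k - i) + (r : ℕ), by have := r.isLt; omega⟩
        ⟨(c : ℕ), by have := c.isLt; omega⟩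
    else
      A.adjugate ⟨n - i + ((r : ℕ) - (k - i)), by have := r.isLt; omega⟩
        ⟨(c : ℕ), by have := c.isLt; omega⟩)

/-- The generic matrix `X = (x_{ab})` over the polynomial ring `K[x]` in the
`n²` matrix entries. -/
noncomputable def genMatrix (K : Type*) [CommRing K] (n : ℕ) :
    Matrix (Fin n) (Fin n) (MvPolynomial (Fin n × Fin n) K) :=
  Matrix.of fun a b => MvPolynomial.X (a, b)

/-- The `K`-algebra endomorphism `ρ_u` of `K[x] = K[x_{ab}]` sending each
`x_{ab}` to the `(a,b)` entry of `u⁻¹ X u`, where `X` is the generic matrix. -/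
noncomputable def rho {n : ℕ} {K : Type*} [Field K]
    (u : Matrix (Fin n) (Fin n) K) :
    MvPolynomial (Fin n × Fin n) K →ₐ[K] MvPolynomial (Fin n × Fin n) K :=
  MvPolynomial.aeval fun ab =>
    (((u⁻¹).map MvPolynomial.C * genMatrix K n * u.map MvPolynomial.C :
      Matrix (Fin n) (Fin n) (MvPolynomial (Fin n × Fin n) K)) ab.1 ab.2)

theorem aux_det_submatrix {ι κ R : Type*} [CommRing R] [Fintype ι] [DecidableEq ι] [Fintype κ]
    [DecidableEq κ] (e₁ e₂ : κ ≃ ι) (M : Matrix ι ι R) :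
    M.det = (M.submatrix e₁ e₂).det ∨ M.det = -(M.submatrix e₁ e₂).det := by
  have h := Matrix.det_reindex e₁.symm e₂.symm M
  simp only [Matrix.reindex_apply, Equiv.symm_symm] at h
  rw [h]
  rcases Int.units_eq_one_or (Equiv.Perm.sign (e₂.symm.trans e₁)) with h1 | h1 <;> simp [h1]

/-- The block determinant. -/
theorem aux_block_det {R : Type*} [CommRing R] (m i : ℕ) (p q : ℕ → ℕ → R)
    (hq : ∀ r c, r < i → i ≤ c → q r c = 0) :
    (Matrix.of fun r c : Fin (m + i) => if (r : ℕ) < m then p r c else q (r - m) c).det =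
      (Matrix.of fun r c : Fin m => p r (i + c)).det * (Matrix.of fun r c : Fin i => q r c).det ∨
    (Matrix.of fun r c : Fin (m + i) => if (r : ℕ) < m then p r c else q (r - m) c).det =
      -((Matrix.of fun r c : Fin m => p r (i + c)).det *
        (Matrix.of fun r c : Fin i => q r c).det) := by
  set M := (Matrix.of fun r c : Fin (m + i) => if (r : ℕ) < m then p r c else q (r - m) c)
  let e₁ : Fin m ⊕ Fin i ≃ Fin (m + i) := finSumFinEquiv
  let e₂ : Fin m ⊕ Fin i ≃ Fin (m + i) :=
    (Equiv.sumComm _ _).trans (finSumFinEquiv.trans (finCongr (add_comm i m)))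
  have key : M.submatrix e₁ e₂ = Matrix.fromBlocks (Matrix.of fun r c : Fin m => p r (i + c))
      (Matrix.of fun (r : Fin m) (c : Fin i) => p r c) 0
      (Matrix.of fun r c : Fin i => q r c) := by
    ext r c
    rcases r with r | r <;> rcases c with c | c <;>
      simp [M, e₁, e₂]
    · rw [add_comm]
    · exact hq _ _ r.2 (Nat.le_add_left _ _)
  have := aux_det_submatrix e₁ e₂ M
  rwa [key, Matrix.det_fromBlocks_zero₂₁] at this

/-- anti-triangular determinants -/
theorem aux_antitri_det {R : Type*} [CommRing R] (m : ℕ) (M : Matrix (Fin m) (Fin m) R)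
    (h : ∀ a b : Fin m, (a : ℕ) + b + 1 < m → M a b = 0) :
    M.det = ∏ j : Fin m, M j.rev j ∨ M.det = -∏ j : Fin m, M j.rev j := by
  have := aux_det_submatrix Fin.revPerm (Equiv.refl _) M
  rwa [Matrix.det_of_isUpperTriangular (M := M.submatrix _ _)] at this
  intro a b hab
  apply h
  replace hab : b < a := hab
  replace hab := Fin.lt_def.1 hab
  simp [Fin.val_rev] at hab ⊢
  omega

theorem aux_antitri_det' {R : Type*} [CommRing R] (m : ℕ) (M : Matrix (Fin m) (Fin m) R)
    (h : ∀ a b : Fin m, m ≤ (a : ℕ) + b → M a b = 0) :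
    M.det = ∏ j : Fin m, M j.rev j ∨ M.det = -∏ j : Fin m, M j.rev j := by
  have := aux_det_submatrix Fin.revPerm (Equiv.refl _) M
  rwa [Matrix.det_of_isLowerTriangular (M := M.submatrix _ _)] at this
  intro a b hab
  apply h
  replace hab : a < b := hab
  replace hab := Fin.lt_def.1 hab
  simp [Fin.val_rev] at hab ⊢
  omega

/-- Solving for the corner entry. -/
theorem aux_corner {L : Type*} [Field L] (F : Subfield L) (m : ℕ)
    (A : Matrix (Fin (m + 1)) (Fin (m + 1)) L)
    (hA : ∀ a b, (a = 0 → b ≠ Fin.last m) → A a b ∈ F) (hdet : A.det ∈ F)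
    (hmin : (A.submatrix Fin.succ Fin.castSucc).det ≠ 0) : A 0 (Fin.last m) ∈ F := by
  have hdetF : ∀ (k : ℕ) (B : Matrix (Fin k) (Fin k) L), (∀ a b, B a b ∈ F) → B.det ∈ F := by
    intro k B hB
    rw [Matrix.det_apply]
    refine sum_mem fun σ _ => ?_
    rw [Units.smul_def]
    exact zsmul_mem (prod_mem fun _ _ => hB _ _) _
  rw [Matrix.det_succ_row_zero, Fin.sum_univ_castSucc] at hdet
  have h1 : ∀ j : Fin (m+1), (A.submatrix Fin.succ j.succAbove).det ∈ F := fun j =>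
    hdetF _ _ fun a b => hA _ _ fun h => absurd h (Fin.succ_ne_zero _)
  have hs : ∀ k : ℕ, ((-1 : L)) ^ k ∈ F := fun k => pow_mem (neg_mem F.one_mem) k
  have h2 := (add_mem_cancel_left (sum_mem fun j _ => mul_mem (mul_mem (hs _)
    (hA 0 (Fin.castSucc j) fun _ => (Fin.castSucc_lt_last j).ne)) (h1 _))).1 hdet
  have h3 := h1 (Fin.last m)
  have h4 : (A.submatrix Fin.succ (Fin.last m).succAbove) = A.submatrix Fin.succ Fin.castSucc := by
    simp [Fin.succAbove_last]
  rw [h4] at h2 h3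
  have h5 := mul_mem (mul_mem (hs m) h2) (inv_mem h3)
  convert h5 using 1
  have : ((-1 : L)) ^ m * (-1) ^ m = 1 := by rw [← mul_pow]; simp
  simp only [Fin.val_last]
  field_simp
  rw [pow_right_comm]; simp

/-- Extension of a matrix by zero to indices in `ℕ`. -/
def auxExt {n : ℕ} {R : Type*} [CommRing R] (S : Matrix (Fin n) (Fin n) R) (a b : ℕ) : R :=
  if h : a < n ∧ b < n then S ⟨a, h.1⟩ ⟨b, h.2⟩ else 0

theorem auxExt_of_lt {n : ℕ} {R : Type*} [CommRing R] (S : Matrix (Fin n) (Fin n) R) {a b : ℕ}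
    (ha : a < n) (hb : b < n) : auxExt S a b = S ⟨a, ha⟩ ⟨b, hb⟩ := by
  simp [auxExt, ha, hb]

/-- The contiguous block starting at `(a,b)`. -/
def auxBlk {R : Type*} (s : ℕ → ℕ → R) (a b m : ℕ) : Matrix (Fin m) (Fin m) R :=
  Matrix.of fun r c => s (a + r) (b + c)

theorem aux_Jki_eq {n : ℕ} {R : Type*} [CommRing R] (S : Matrix (Fin n) (Fin n) R) (m i : ℕ)
    (hk : m + i ≤ n) (hik : i < m + i) :
    Jki (m + i) i hk hik S = (Matrix.of fun r c : Fin (m + i) =>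
      if (r : ℕ) < m then auxExt S (n - m + r) c
      else auxExt S.adjugate (n - i + (r - m)) c).det := by
  unfold Jki
  congr 1
  ext r c
  have h : m + i - i = m := by omega
  have hr := r.2
  have hc := c.2
  simp only [h, Matrix.of_apply]
  split_ifs
  · rw [auxExt_of_lt]
  · rw [auxExt_of_lt]

section field
variable {n : ℕ} {L : Type*} [Field L] (S : Matrix (Fin n) (Fin n) L)

theorem aux_adj_zero (hS : ∀ a b : Fin n, (a : ℕ) + b + 1 < n → S a b = 0) (hd : S.det ≠ 0)
    (b c : Fin n) (h : n ≤ (b : ℕ) + c) : S.adjugate b c = 0 := by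
  have hB : (S.submatrix Fin.revPerm (Equiv.refl _)).BlockTriangular id := by
    intro a b hab
    apply hS
    replace hab := Fin.lt_def.1 hab
    simp [Fin.val_rev] at hab ⊢
    omega
  have hdB : IsUnit (S.submatrix Fin.revPerm (Equiv.refl _)).det := by
    rcases aux_det_submatrix Fin.revPerm (Equiv.refl _) S with h | h <;> rw [h] at hd <;>
      simpa using hd
  have := Matrix.invertibleOfIsUnitDet _ hdB
  have h1 := Matrix.blockTriangular_inv_of_blockTriangular hB
  rw [Matrix.inv_submatrix_equiv] at h1
  have h2 : S⁻¹ b c = 0 := by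
    have h3 := @h1 b c.rev (by simp [Fin.lt_def, Fin.val_rev]; omega)
    simpa using h3
  rw [Matrix.inv_def] at h2
  simp only [Matrix.smul_apply, smul_eq_mul, mul_eq_zero] at h2
  rcases h2 with h2 | h2
  · simp [hd] at h2
  · exact h2

theorem aux_adj_diag (hS : ∀ a b : Fin n, (a : ℕ) + b + 1 < n → S a b = 0) (hd : S.det ≠ 0)
    (a : Fin n) : S a a.rev * S.adjugate a.rev a = S.det := by
  have h := congrFun (congrFun (Matrix.mul_adjugate S) a) a
  rw [Matrix.mul_apply, Finset.sum_eq_single a.rev] at h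
  · simpa using h
  · intro b _ hb
    by_cases hab : (a : ℕ) + b + 1 < n
    · rw [hS _ _ hab, zero_mul]
    · rw [aux_adj_zero S hS hd b a, mul_zero]
      have : (b : ℕ) ≠ a.rev := fun h => hb (Fin.ext h)
      rw [Fin.val_rev] at this
      omega
  · simp

theorem aux_J_factor (hS : ∀ a b : Fin n, (a : ℕ) + b + 1 < n → S a b = 0) (hd : S.det ≠ 0)
    (m i : ℕ) (hk : m + i ≤ n) (hik : i < m + i) :
    Jki (m + i) i hk hik S =
      (auxBlk (auxExt S) (n - m) i m).det * (auxBlk (auxExt S.adjugate) (n - i) 0 i).det ∨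
    Jki (m + i) i hk hik S =
      -((auxBlk (auxExt S) (n - m) i m).det * (auxBlk (auxExt S.adjugate) (n - i) 0 i).det) := by
  rw [aux_Jki_eq]
  have := aux_block_det m i (fun r c => auxExt S (n - m + r) c)
    (fun r c => auxExt S.adjugate (n - i + r) c) (by
      intro r c hr hc
      by_cases hcn : c < n
      · rw [auxExt_of_lt _ (by omega) hcn]
        exact aux_adj_zero S hS hd _ _ (by simp; omega)
      · simp [auxExt, hcn])
  simpa [auxBlk] using this

theorem aux_det_T (hS : ∀ a b : Fin n, (a : ℕ) + b + 1 < n → S a b = 0) (hd : S.det ≠ 0)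
    (i : ℕ) (hi : i ≤ n) :
    (auxBlk (auxExt S.adjugate) (n - i) 0 i).det =
      ∏ j ∈ Finset.range i, auxExt S.adjugate (n - 1 - j) j ∨
    (auxBlk (auxExt S.adjugate) (n - i) 0 i).det =
      -∏ j ∈ Finset.range i, auxExt S.adjugate (n - 1 - j) j := by
  have := aux_antitri_det' i (auxBlk (auxExt S.adjugate) (n - i) 0 i) (by
    intro a b hab
    have := a.2
    have := b.2
    simp only [auxBlk, Matrix.of_apply]
    rw [auxExt_of_lt _ (by omega) (by omega)]
    exact aux_adj_zero S hS hd _ _ (by simp; omega))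
  rw [Finset.prod_range]
  convert this using 4 <;>
  · rename_i j _
    simp only [auxBlk, Matrix.of_apply]
    have := j.2
    congr 1
    · rw [Fin.val_rev]; omega
    · omega

theorem aux_det_D (hS : ∀ a b : Fin n, (a : ℕ) + b + 1 < n → S a b = 0)
    (m : ℕ) (hm : m ≤ n) :
    (auxBlk (auxExt S) (n - m) 0 m).det =
      ∏ j ∈ Finset.range m, auxExt S (n - 1 - j) j ∨
    (auxBlk (auxExt S) (n - m) 0 m).det =
      -∏ j ∈ Finset.range m, auxExt S (n - 1 - j) j := by
  have := aux_antitri_det m (auxBlk (auxExt S) (n - m) 0 m) (by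
    intro a b hab
    have := a.2
    have := b.2
    simp only [auxBlk, Matrix.of_apply]
    rw [auxExt_of_lt _ (by omega) (by omega)]
    exact hS _ _ (by simp; omega))
  rw [Finset.prod_range]
  convert this using 4 <;>
  · rename_i j _
    simp only [auxBlk, Matrix.of_apply]
    have := j.2
    congr 1
    · rw [Fin.val_rev]; omega
    · omega

theorem aux_diag_mul (hS : ∀ a b : Fin n, (a : ℕ) + b + 1 < n → S a b = 0) (hd : S.det ≠ 0)
    (j : ℕ) (hj : j < n) :
    auxExt S (n - 1 - (n - 1 - j)) (n - 1 - j) * auxExt S.adjugate (n - 1 - j) j = S.det := by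
  rw [auxExt_of_lt _ (by omega) (by omega), auxExt_of_lt _ (by omega) (by omega),
    ← aux_adj_diag S hS hd ⟨j, hj⟩]
  congr 2
  · ext; simp; omega
  · ext; simp; omega
  · ext; simp; omega

theorem aux_det_T_ne (hS : ∀ a b : Fin n, (a : ℕ) + b + 1 < n → S a b = 0) (hd : S.det ≠ 0)
    (i : ℕ) (hi : i ≤ n) : (auxBlk (auxExt S.adjugate) (n - i) 0 i).det ≠ 0 := by
  have : ∏ j ∈ Finset.range i, auxExt S.adjugate (n - 1 - j) j ≠ 0 := by
    rw [Finset.prod_ne_zero_iff]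
    intro j hj h0
    rw [Finset.mem_range] at hj
    have := aux_diag_mul S hS hd j (by omega)
    rw [h0, mul_zero] at this
    exact hd this.symm
  rcases aux_det_T S hS hd i hi with h | h <;> rw [h]
  · exact this
  · exact neg_ne_zero.2 this

theorem aux_mem (hn : 1 ≤ n) (F : Subfield L)
    (hS : ∀ a b : Fin n, (a : ℕ) + b + 1 < n → S a b = 0)
    (hd : S.det ≠ 0)
    (hJ : ∀ k i (hk : k ≤ n) (hik : i < k), Jki k i hk hik S ∈ F)
    (hJ0 : ∀ k i (hk : k ≤ n) (hik : i < k), Jki k i hk hik S ≠ 0) :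
    ∀ a b, S a b ∈ F := by
  have hpm : ∀ x y : L, x = y ∨ x = -y → (x ∈ F ↔ y ∈ F) := by
    rintro x y (rfl | rfl)
    · rfl
    · exact neg_mem_iff
  have hpm0 : ∀ x y : L, x = y ∨ x = -y → (x ≠ 0 ↔ y ≠ 0) := by
    rintro x y (rfl | rfl)
    · rfl
    · exact neg_ne_zero
  have hD0 : ∀ m, m ≤ n → (auxBlk (auxExt S) (n - m) 0 m).det ∈ F ∧
      (auxBlk (auxExt S) (n - m) 0 m).det ≠ 0 := by
    intro m hm
    rcases Nat.eq_zero_or_pos m with rfl | h0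
    · simp
    · have h := aux_J_factor S hS hd m 0 (by omega) (by omega)
      have hT : (auxBlk (auxExt S.adjugate) (n - 0) 0 0).det = 1 := by simp
      rw [hT, mul_one] at h
      exact ⟨(hpm _ _ h).1 (hJ _ _ _ _), (hpm0 _ _ h).1 (hJ0 _ _ _ _)⟩
  have hP : ∀ m, m ≤ n → ∏ j ∈ Finset.range m, auxExt S (n - 1 - j) j ∈ F ∧
      ∏ j ∈ Finset.range m, auxExt S (n - 1 - j) j ≠ 0 := fun m hm =>
    ⟨(hpm _ _ (aux_det_D S hS m hm)).1 (hD0 m hm).1, (hpm0 _ _ (aux_det_D S hS m hm)).1 (hD0 m hm).2⟩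
  have hdiag : ∀ m, m < n → auxExt S (n - 1 - m) m ∈ F := by
    intro m hm
    have h1 := hP (m + 1) hm
    have h2 := hP m hm.le
    rw [Finset.prod_range_succ] at h1
    have := div_mem h1.1 h2.1
    rwa [mul_div_cancel_left₀ _ h2.2] at this
  have hdetF : S.det ∈ F := by
    have h := (hD0 n le_rfl).1
    convert h using 2
    ext a b
    simp [auxBlk, auxExt]
  have hadj : ∀ j, j < n → auxExt S.adjugate (n - 1 - j) j ∈ F := by
    intro j hj
    have h := aux_diag_mul S hS hd j hj
    have h0 : auxExt S (n - 1 - (n - 1 - j)) (n - 1 - j) ≠ 0 := by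
      intro h0
      rw [h0, zero_mul] at h
      exact hd h.symm
    replace h := eq_div_of_mul_eq h0 ((mul_comm _ _).trans h)
    rw [h]
    exact div_mem hdetF (hdiag _ (by omega))
  have hT : ∀ i, i ≤ n → (auxBlk (auxExt S.adjugate) (n - i) 0 i).det ∈ F := by
    intro i hi
    rw [hpm _ _ (aux_det_T S hS hd i hi)]
    refine prod_mem fun j hj => hadj j ?_
    rw [Finset.mem_range] at hj
    omega
  have hD : ∀ m i, m + i ≤ n → (auxBlk (auxExt S) (n - m) i m).det ∈ F ∧
      (auxBlk (auxExt S) (n - m) i m).det ≠ 0 := by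
    intro m i hm
    rcases Nat.eq_zero_or_pos m with rfl | h0
    · simp
    · have h := aux_J_factor S hS hd m i hm (by omega)
      have h1 := (hpm _ _ h).1 (hJ _ _ _ _)
      have h2 := (hpm0 _ _ h).1 (hJ0 _ _ _ _)
      refine ⟨?_, left_ne_zero_of_mul h2⟩
      have h3 := div_mem h1 (hT i (by omega))
      rwa [mul_div_cancel_right₀ _ (right_ne_zero_of_mul h2)] at h3
  have main : ∀ m, m < n → ∀ c, c < n → auxExt S (n - (m + 1)) c ∈ F := by
    intro m
    induction m using Nat.strong_induction_on with
    | _ m ihm =>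
    intro hm c
    induction c using Nat.strong_induction_on with
    | _ c ihc =>
    intro hc
    by_cases hcm : c < m
    · rw [auxExt_of_lt _ (by omega) hc, hS _ _ (by simp; omega)]
      exact F.zero_mem
    · obtain ⟨i, rfl⟩ : ∃ i, c = i + m := ⟨c - m, by omega⟩
      have := aux_corner F m (auxBlk (auxExt S) (n - (m + 1)) i (m + 1)) ?_ 
        (hD (m + 1) i (by omega)).1 ?_
      · simpa [auxBlk] using this
      · intro a b hab
        simp only [auxBlk, Matrix.of_apply]
        have hb := b.2
        have ha := a.2
        by_cases ha0 : a = 0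
        · have h1 := hab ha0
          have h2 : (b : ℕ) ≠ m := fun h => h1 (Fin.ext h)
          subst ha0
          exact ihc _ (by omega) (by omega)
        · have h2 : (a : ℕ) ≠ 0 := fun h => ha0 (Fin.ext h)
          have := ihm (m - a) (by omega) (by omega) (i + b) (by omega)
          convert this using 2
          omega
      · have := (hD m i (by omega)).2
        convert this using 2
        ext a b
        simp only [auxBlk, Matrix.of_apply, Matrix.submatrix_apply]
        congr 1
        simp
        omega
  intro a b
  have := main (n - 1 - a) (by omega) b b.2
  rw [auxExt_of_lt _ (by omega) b.2] at this
  convert this using 2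
  ext
  simp
  omega

end field

theorem aux_Jki_map {n : ℕ} {R R' : Type*} [CommRing R] [CommRing R'] (f : R →+* R') (k i : ℕ)
    (hk : k ≤ n) (hik : i < k) (A : Matrix (Fin n) (Fin n) R) :
    f (Jki k i hk hik A) = Jki k i hk hik (A.map f) := by
  unfold Jki
  rw [RingHom.map_det]
  congr 1
  have h : (A.map f).adjugate = A.adjugate.map f := (RingHom.map_adjugate f A).symm
  ext r c
  rw [h]
  simp only [RingHom.mapMatrix_apply, Matrix.map_apply, Matrix.of_apply]
  split_ifs <;> rfl

theorem aux_uni_det {n : ℕ} {R : Type*} [CommRing R] {u : Matrix (Fin n) (Fin n) R}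
    (hu : IsUniUpperTriangular u) : u.det = 1 := by
  rw [Matrix.det_of_isUpperTriangular (M := u)]
  · simp [hu.1]
  · intro a b hab
    exact hu.2 _ _ hab

theorem aux_uni_inv {n : ℕ} {L : Type*} [Field L] {u : Matrix (Fin n) (Fin n) L}
    (hu : IsUniUpperTriangular u) : IsUniUpperTriangular u⁻¹ := by
  have hB : u.BlockTriangular id := fun a b hab => hu.2 _ _ hab
  have hd : IsUnit u.det := by rw [aux_uni_det hu]; exact isUnit_one
  have := Matrix.invertibleOfIsUnitDet _ hd
  have h1 := Matrix.blockTriangular_inv_of_blockTriangular hB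
  refine ⟨fun a => ?_, fun a b hab => h1 hab⟩
  have h2 := congrFun (congrFun (Matrix.mul_nonsing_inv u hd) a) a
  rw [Matrix.mul_apply, Finset.sum_eq_single a] at h2
  · simpa [hu.1] using h2
  · intro b _ hb
    rcases lt_or_gt_of_ne hb with h | h
    · rw [hu.2 _ _ h, zero_mul]
    · rw [h1 h, mul_zero]
  · simp

theorem aux_uni_map {n : ℕ} {R R' : Type*} [CommRing R] [CommRing R'] (f : R →+* R')
    {u : Matrix (Fin n) (Fin n) R}
    (hu : IsUniUpperTriangular u) : IsUniUpperTriangular (u.map f) :=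
  ⟨fun a => by simp [hu.1], fun a b h => by simp [hu.2 a b h]⟩

theorem aux_uni_mul {n : ℕ} {R : Type*} [CommRing R]
    {u v : Matrix (Fin n) (Fin n) R}
    (hu : IsUniUpperTriangular u) (hv : IsUniUpperTriangular v) :
    IsUniUpperTriangular (u * v) := by
  have h1 : u.BlockTriangular id := fun a b hab => hu.2 _ _ hab
  have h2 : v.BlockTriangular id := fun a b hab => hv.2 _ _ hab
  refine ⟨fun a => ?_, fun a b hab => (h1.mul h2) hab⟩
  rw [Matrix.mul_apply, Finset.sum_eq_single a]
  · simp [hu.1, hv.1]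
  · intro b _ hb
    rcases lt_or_gt_of_ne hb with h | h
    · rw [hu.2 _ _ h, zero_mul]
    · rw [hv.2 _ _ h, mul_zero]
  · simp

theorem aux_Jki_conj {n : ℕ} {R : Type*} [CommRing R] (k i : ℕ)
    (hk : k ≤ n) (hik : i < k) (A u v : Matrix (Fin n) (Fin n) R)
    (hu : IsUniUpperTriangular u) (hv : IsUniUpperTriangular v) (hvu : v * u = 1) :
    Jki k i hk hik (v * A * u) = Jki k i hk hik A := by
  have huv : u * v = 1 := mul_eq_one_comm.1 hvu
  have hadju : u.adjugate = v := by
    have := Matrix.mul_adjugate u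
    rw [aux_uni_det hu, one_smul] at this
    calc u.adjugate = (v * u) * u.adjugate := by rw [hvu, one_mul]
      _ = v := by rw [mul_assoc, this, mul_one]
  have hadjv : v.adjugate = u := by
    have := Matrix.mul_adjugate v
    rw [aux_uni_det hv, one_smul] at this
    calc v.adjugate = (u * v) * v.adjugate := by rw [huv, one_mul]
      _ = u := by rw [mul_assoc, this, mul_one]
  have hadj : (v * A * u).adjugate = v * A.adjugate * u := by
    rw [Matrix.adjugate_mul_distrib, Matrix.adjugate_mul_distrib, hadju, hadjv, mul_assoc]
  let f : Fin k → Fin n := fun r => if h : (r : ℕ) < k - i then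
    ⟨n - (k - i) + (r : ℕ), by have := r.isLt; omega⟩ else
    ⟨n - i + ((r : ℕ) - (k - i)), by have := r.isLt; omega⟩
  let W : Matrix (Fin n) (Fin n) R → Matrix (Fin n) (Fin n) R → Matrix (Fin k) (Fin n) R :=
    fun A B => Matrix.of fun r c => if (r : ℕ) < k - i then A (f r) c else B (f r) c
  have hJ : ∀ A : Matrix (Fin n) (Fin n) R, Jki k i hk hik A =
      ((W A A.adjugate).submatrix id (Fin.castLE hk)).det := by
    intro A
    unfold Jki
    congr 1
    ext r c
    simp only [W, f, Matrix.of_apply, Matrix.submatrix_apply, id]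
    split_ifs <;> rfl
  let P : Matrix (Fin k) (Fin k) R := Matrix.of fun r s =>
    if ((r : ℕ) < k - i ↔ (s : ℕ) < k - i) then v (f r) (f s) else 0
  have hf : ∀ r : Fin k, (f r : ℕ) = if (r : ℕ) < k - i then n - (k - i) + r
      else n - i + (r - (k - i)) := by
    intro r
    simp only [f]
    split_ifs <;> rfl
  have hPdet : P.det = 1 := by
    apply aux_uni_det
    refine ⟨fun a => by simp [P, hv.1], fun a b hab => ?_⟩
    simp only [P, Matrix.of_apply]
    split_ifs with h
    · apply hv.2
      rw [hf, hf]
      by_cases hb : (b : ℕ) < k - i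
      · rw [if_pos hb, if_pos (h.2 hb)]; omega
      · rw [if_neg hb, if_neg (fun h' => hb (h.1 h'))]; omega
    · rfl
  have hsum : ∀ (B : Matrix (Fin n) (Fin n) R) (r : Fin k) (c : Fin n),
      (v * B) (f r) c = ∑ s : Fin k, P r s * B (f s) c := by
    intro B r c
    rw [Matrix.mul_apply]
    have : ∑ s : Fin k, P r s * B (f s) c = ∑ s ∈ Finset.univ.filter
        (fun s : Fin k => ((r : ℕ) < k - i ↔ (s : ℕ) < k - i)), v (f r) (f s) * B (f s) c := by
      rw [Finset.sum_filter]
      refine Finset.sum_congr rfl fun s _ => ?_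
      simp only [P, Matrix.of_apply]
      split_ifs <;> simp
    rw [this]
    symm
    refine Finset.sum_of_injOn f ?_ (by simp) ?_ (fun _ _ => rfl)
    · intro s hs s' hs' hss
      simp only [Finset.coe_filter, Finset.mem_univ, true_and, Set.mem_ofPred_eq] at hs hs'
      have h1 := congrArg Fin.val hss
      rw [hf, hf] at h1
      ext
      have := s.2
      have := s'.2
      split_ifs at h1 <;> first | omega | tauto
    · intro y _ hy
      by_cases hlt : (y : ℕ) < f r
      · rw [hv.2 _ _ hlt, zero_mul]
      · exfalso
        apply hy
        rw [hf] at hlt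
        have := y.2
        have := r.2
        split_ifs at hlt with hr
        · refine ⟨⟨y - (n - (k - i)), by omega⟩, ?_, ?_⟩
          · simp [hr]; omega
          · ext
            rw [hf]
            simp only
            rw [if_pos (by omega)]; omega
        · refine ⟨⟨y - (n - i) + (k - i), by omega⟩, ?_, ?_⟩
          · simp; omega
          · ext
            rw [hf]
            simp only
            rw [if_neg (by omega)]; omega
  have hW : ∀ A B : Matrix (Fin n) (Fin n) R, W (v * A * u) (v * B * u) = P * W A B * u := by
    intro A B
    ext r c
    have h1 : ∀ r c, (P * W A B) r c = if (r : ℕ) < k - i then (v * A) (f r) c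
        else (v * B) (f r) c := by
      intro r c
      rw [hsum, hsum, Matrix.mul_apply]
      split_ifs with hr
      · refine Finset.sum_congr rfl fun s _ => ?_
        simp only [P, W, Matrix.of_apply]
        split_ifs <;> first | rfl | simp only [zero_mul] | tauto
      · refine Finset.sum_congr rfl fun s _ => ?_
        simp only [P, W, Matrix.of_apply]
        split_ifs <;> first | rfl | simp only [zero_mul] | tauto
    rw [Matrix.mul_apply]
    simp only [h1, W, Matrix.of_apply]
    split_ifs <;> rw [Matrix.mul_apply]
  have hcol : ∀ B : Matrix (Fin k) (Fin n) R, (B * u).submatrix id (Fin.castLE hk) =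
      B.submatrix id (Fin.castLE hk) * u.submatrix (Fin.castLE hk) (Fin.castLE hk) := by
    intro B
    ext r c
    simp only [Matrix.submatrix_apply, Matrix.mul_apply, id]
    symm
    refine Finset.sum_of_injOn (Fin.castLE hk) ?_ (by simp) ?_ (fun _ _ => rfl)
    · exact (Fin.castLE_injective hk).injOn
    · intro y _ hy
      rw [hu.2 y (Fin.castLE hk c), mul_zero]
      by_contra hlt
      apply hy
      have := c.2
      simp only [Fin.val_castLE] at hlt
      exact ⟨⟨y, by omega⟩, by simp, by ext; simp⟩
  have hudet : (u.submatrix (Fin.castLE hk) (Fin.castLE hk)).det = 1 := by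
    apply aux_uni_det
    exact ⟨fun a => by simp [hu.1], fun a b hab => hu.2 _ _ (by simpa using hab)⟩
  have hPW : ∀ B : Matrix (Fin k) (Fin n) R, (P * B).submatrix id (Fin.castLE hk) =
      P * B.submatrix id (Fin.castLE hk) := fun B => by
    ext; simp [Matrix.mul_apply]
  rw [hJ, hJ, hadj, hW, hcol, Matrix.det_mul, hudet, mul_one, hPW, Matrix.det_mul, hPdet, one_mul]

theorem aux_exists_v {n : ℕ} {L : Type*} [Field L] (A : Matrix (Fin n) (Fin n) L)
    (hA : ∀ k (hk : k ≤ n) (hik : 0 < k), Jki k 0 hk hik A ≠ 0) :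
    ∃ v : Matrix (Fin n) (Fin n) L, IsUniUpperTriangular v ∧
      ∀ a b : Fin n, (a : ℕ) + b + 1 < n → (v * A) a b = 0 := by
  have row : ∀ a : Fin n, ∃ w : Fin n → L, w a = 1 ∧ (∀ b : Fin n, (b : ℕ) < a → w b = 0) ∧
      ∀ c : Fin n, (a : ℕ) + c + 1 < n → (w ᵥ* A) c = 0 := by
    intro a
    have ha := a.2
    obtain ⟨k, hk⟩ : ∃ k, n = a + 1 + k := ⟨n - 1 - a, by omega⟩
    set M : Matrix (Fin k) (Fin k) L :=
      Matrix.of fun r c => A ⟨a + 1 + r, by omega⟩ ⟨c, by omega⟩ with hM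
    have hMdet : M.det ≠ 0 := by
      rcases Nat.eq_zero_or_pos k with rfl | h0
      · simp
      · have := hA k (by omega) h0
        convert this using 1
        unfold Jki
        congr 1
        ext r c
        have hr := r.2
        simp only [Matrix.of_apply, hM, Nat.sub_zero]
        rw [dif_pos hr]
        congr 2
        omega
    set x : Fin k → L := fun c => A a ⟨c, by omega⟩ with hx
    set z : Fin k → L := (-x) ᵥ* M⁻¹ with hz
    have hzM : z ᵥ* M = -x := by
      rw [hz, Matrix.vecMul_vecMul, Matrix.nonsing_inv_mul _ (isUnit_iff_ne_zero.2 hMdet),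
        Matrix.vecMul_one]
    refine ⟨Pi.single a 1 + ∑ j : Fin k, z j • Pi.single (⟨a + 1 + j, by omega⟩ : Fin n) (1 : L),
      ?_, ?_, ?_⟩
    · simp only [Pi.add_apply, Pi.single_eq_same, Finset.sum_apply, Pi.smul_apply, smul_eq_mul]
      rw [Finset.sum_eq_zero, add_zero]
      intro j _
      rw [Pi.single_eq_of_ne, mul_zero]
      intro h
      have := congrArg Fin.val h
      simp at this
      omega
    · intro b hb
      simp only [Pi.add_apply, Finset.sum_apply, Pi.smul_apply, smul_eq_mul]
      rw [Finset.sum_eq_zero, add_zero, Pi.single_eq_of_ne]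
      · intro h
        rw [h] at hb
        omega
      intro j _
      rw [Pi.single_eq_of_ne, mul_zero]
      intro h
      have := congrArg Fin.val h
      simp at this
      omega
    · intro c hc
      have h1 := congrFun hzM ⟨c, by omega⟩
      rw [Matrix.add_vecMul, Matrix.sum_vecMul]
      simp only [Matrix.smul_vecMul, Matrix.single_one_vecMul, Pi.add_apply, Finset.sum_apply,
        Pi.smul_apply, smul_eq_mul, Matrix.row_apply]
      simp only [Matrix.vecMul, dotProduct, hM, Matrix.of_apply, Pi.neg_apply, hx] at h1
      rw [h1]
      simp
  choose w hw1 hw2 hw3 using row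
  refine ⟨Matrix.of w, ⟨fun a => hw1 a, fun a b h => hw2 a b h⟩, fun a b h => ?_⟩
  exact hw3 a b h

/-- The unitriangular matrix with given entries above the diagonal. -/
def auxUni {n : ℕ} {R : Type*} [CommRing R] (y : Fin n × Fin n → R) : Matrix (Fin n) (Fin n) R :=
  Matrix.of fun a b => if a = b then 1 else if a < b then y (a, b) else 0

theorem auxUni_uni {n : ℕ} {R : Type*} [CommRing R] (y : Fin n × Fin n → R) :
    IsUniUpperTriangular (auxUni y) := by
  refine ⟨fun a => by simp [auxUni], fun a b h => ?_⟩
  have h' : b < a := h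
  simp [auxUni, h'.ne', h'.not_gt]

theorem auxUni_eq {n : ℕ} {R : Type*} [CommRing R] {u : Matrix (Fin n) (Fin n) R}
    (hu : IsUniUpperTriangular u) : auxUni (fun ab => u ab.1 ab.2) = u := by
  ext a b
  simp only [auxUni, Matrix.of_apply]
  split_ifs with h1 h2
  · rw [h1, hu.1]
  · rfl
  · rw [hu.2]
    exact lt_of_le_of_ne (not_lt.1 h2) (fun h => h1 (Fin.ext h.symm))

theorem auxUni_map {n : ℕ} {R R' : Type*} [CommRing R] [CommRing R'] (f : R →+* R')
    (y : Fin n × Fin n → R) : (auxUni y).map f = auxUni (fun ab => f (y ab)) := by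
  ext a b
  simp only [auxUni, Matrix.of_apply, Matrix.map_apply]
  split_ifs <;> simp

theorem aux_uni_inv_eq {n : ℕ} {L : Type*} [Field L] {u : Matrix (Fin n) (Fin n) L}
    (hu : IsUniUpperTriangular u) : u⁻¹ = u.adjugate := by
  rw [Matrix.inv_def, aux_uni_det hu]; simp

theorem aux_density {n : ℕ} {K L : Type*} [Field K] [Infinite K] [Field L] [Algebra K L]
    (Y : Matrix (Fin n) (Fin n) L) (p₁ p₂ : MvPolynomial (Fin n × Fin n) K) (α β : L)
    (h : ∀ u : Matrix (Fin n) (Fin n) K, IsUniUpperTriangular u →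
      MvPolynomial.aeval (fun ab : Fin n × Fin n =>
        ((u.map (algebraMap K L))⁻¹ * Y * u.map (algebraMap K L)) ab.1 ab.2) p₁ * α =
      MvPolynomial.aeval (fun ab : Fin n × Fin n =>
        ((u.map (algebraMap K L))⁻¹ * Y * u.map (algebraMap K L)) ab.1 ab.2) p₂ * β)
    (u : Matrix (Fin n) (Fin n) L) (hu : IsUniUpperTriangular u) :
      MvPolynomial.aeval (fun ab : Fin n × Fin n => (u⁻¹ * Y * u) ab.1 ab.2) p₁ * α =
      MvPolynomial.aeval (fun ab : Fin n × Fin n => (u⁻¹ * Y * u) ab.1 ab.2) p₂ * β := by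
  let V : Matrix (Fin n) (Fin n) (MvPolynomial (Fin n × Fin n) L) := auxUni MvPolynomial.X
  let G : MvPolynomial (Fin n × Fin n) K → MvPolynomial (Fin n × Fin n) L := fun p =>
    MvPolynomial.aeval (fun ab : Fin n × Fin n =>
      (V.adjugate * Y.map MvPolynomial.C * V :
        Matrix (Fin n) (Fin n) (MvPolynomial (Fin n × Fin n) L)) ab.1 ab.2) p
  have hG : ∀ (y : Fin n × Fin n → L) p, MvPolynomial.eval y (G p) =
      MvPolynomial.aeval (fun ab : Fin n × Fin n =>
        ((auxUni y)⁻¹ * Y * auxUni y) ab.1 ab.2) p := by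
    intro y p
    have h1 : ∀ q, MvPolynomial.eval y q =
        ((MvPolynomial.aeval y : MvPolynomial (Fin n × Fin n) L →ₐ[L] L).restrictScalars K) q := by
      intro q
      simp [MvPolynomial.aeval_eq_eval]
    have h2 : V.map (MvPolynomial.eval y) = auxUni y := by
      simp only [V, auxUni_map, MvPolynomial.eval_X]
    have h3 : V.adjugate.map (MvPolynomial.eval y) = (auxUni y)⁻¹ := by
      rw [aux_uni_inv_eq (auxUni_uni y), ← h2]
      exact RingHom.map_adjugate (MvPolynomial.eval y) V
    have h4 : (Y.map MvPolynomial.C).map (MvPolynomial.eval y) = Y := by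
      ext a b; simp
    rw [h1]
    simp only [G]
    rw [MvPolynomial.comp_aeval_apply]
    congr 2
    ext ab
    rw [← h1, ← h2, h2, ← h3, ← h2]
    conv_rhs => rw [← h4]
    rw [← Matrix.map_mul, ← Matrix.map_mul]
    rfl
  have hzero : G p₁ * MvPolynomial.C α = G p₂ * MvPolynomial.C β := by
    apply MvPolynomial.funext_set (fun _ => Set.range (algebraMap K L))
      (fun _ => Set.infinite_range_of_injective (algebraMap K L).injective)
    intro x hx
    choose x' hx' using fun i => hx i (Set.mem_univ i)
    have := h (auxUni x') (auxUni_uni x')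
    rw [auxUni_map] at this
    simp only [hx'] at this
    simpa [hG] using this
  have := congrArg (MvPolynomial.eval (fun ab => u ab.1 ab.2)) hzero
  simpa [hG, auxUni_eq hu] using this

theorem aux_J_ne_zero {n : ℕ} {K : Type*} [Field K] [CharZero K] (k i : ℕ)
    (hk : k ≤ n) (hik : i < k) : Jki k i hk hik (genMatrix K n) ≠ 0 := by
  let S : Matrix (Fin n) (Fin n) K := Matrix.of fun a b =>
    (descPochhammer K (n - 1 - a)).eval (b : K)
  have hS : ∀ a b : Fin n, (a : ℕ) + b + 1 < n → S a b = 0 := by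
    intro a b h
    simp only [S, Matrix.of_apply]
    rw [descPochhammer_eval_eq_descFactorial, Nat.descFactorial_eq_zero_iff_lt.2 (by omega)]
    simp
  have hdet : ∀ m i, m + i ≤ n → (auxBlk (auxExt S) (n - m) i m).det ≠ 0 := by
    intro m i hm
    have hv := Matrix.det_eval_matrixOfPolynomials_eq_det_vandermonde
      (fun c : Fin m => ((i + c : ℕ) : K)) (fun j => descPochhammer K j)
      (fun j => descPochhammer_natDegree K j) (fun j => monic_descPochhammer K j)
    have hv0 : (Matrix.vandermonde (fun c : Fin m => ((i + c : ℕ) : K))).det ≠ 0 := by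
      rw [Matrix.det_vandermonde_ne_zero_iff]
      intro a b hab
      ext
      have := Nat.cast_injective hab
      omega
    rw [hv, ← Matrix.det_transpose] at hv0
    rcases aux_det_submatrix Fin.revPerm (Equiv.refl _) (auxBlk (auxExt S) (n - m) i m)
      with h | h <;> rw [h]
    rotate_left
    rw [neg_ne_zero]
    all_goals
    · convert hv0 using 2
      ext a b
      simp only [auxBlk, Matrix.submatrix_apply, Matrix.of_apply, Matrix.transpose_apply,
        Equiv.refl_apply, Fin.revPerm_apply, Fin.val_rev]
      rw [auxExt_of_lt _ (by omega) (by omega)]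
      simp only [S, Matrix.of_apply]
      congr 2
      omega
  have hd : S.det ≠ 0 := by
    have := hdet n 0 (by omega)
    convert this using 2
    ext a b
    simp [auxBlk, auxExt]
  have hJS : Jki k i hk hik S ≠ 0 := by
    obtain ⟨m, rfl⟩ : ∃ m, k = m + i := ⟨k - i, by omega⟩
    have h0 := mul_ne_zero (hdet m i hk) (aux_det_T_ne S hS hd i (by omega))
    rcases aux_J_factor S hS hd m i hk hik with h | h <;> rw [h]
    · exact h0
    · exact neg_ne_zero.2 h0
  intro h
  apply hJS
  have h1 := aux_Jki_map (MvPolynomial.eval (fun ab : Fin n × Fin n => S ab.1 ab.2)) k i hk hik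
    (genMatrix K n)
  rw [h, map_zero] at h1
  rw [h1]
  congr 1
  ext a b
  simp [genMatrix]

/-- The section. -/
theorem aux_section {n : ℕ} {K : Type*} [Field K] [CharZero K] (hn : 1 ≤ n) :
    ∃ u : Matrix (Fin n) (Fin n) (FractionRing (MvPolynomial (Fin n × Fin n) K)),
      IsUniUpperTriangular u ∧
      ∀ F : Subfield (FractionRing (MvPolynomial (Fin n × Fin n) K)),
        (∀ k i (hk : k ≤ n) (hik : i < k),
          algebraMap (MvPolynomial (Fin n × Fin n) K) (FractionRing (MvPolynomial (Fin n × Fin n) K))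
            (Jki k i hk hik (genMatrix K n)) ∈ F) →
        ∀ a b, (u⁻¹ * (genMatrix K n).map (algebraMap _ _) * u :
          Matrix (Fin n) (Fin n) (FractionRing (MvPolynomial (Fin n × Fin n) K))) a b ∈ F := by
  set Y := (genMatrix K n).map (algebraMap (MvPolynomial (Fin n × Fin n) K)
    (FractionRing (MvPolynomial (Fin n × Fin n) K))) with hY
  have hJY : ∀ k i (hk : k ≤ n) (hik : i < k), Jki k i hk hik Y = algebraMap _ _
      (Jki k i hk hik (genMatrix K n)) := fun k i hk hik => (aux_Jki_map _ k i hk hik _).symm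
  have hJ0 : ∀ k i (hk : k ≤ n) (hik : i < k), Jki k i hk hik Y ≠ 0 := by
    intro k i hk hik
    rw [hJY]
    intro h
    exact aux_J_ne_zero k i hk hik
      ((IsFractionRing.injective (MvPolynomial (Fin n × Fin n) K) _) (h.trans (map_zero _).symm))
  obtain ⟨v, hv, hvA⟩ := aux_exists_v Y (fun k hk hik => hJ0 k 0 hk hik)
  have hvd : IsUnit v.det := by rw [aux_uni_det hv]; exact isUnit_one
  have hu := aux_uni_inv hv
  refine ⟨v⁻¹, hu, fun F hF => ?_⟩
  rw [Matrix.nonsing_inv_nonsing_inv _ hvd]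
  have hconj : ∀ k i (hk : k ≤ n) (hik : i < k), Jki k i hk hik (v * Y * v⁻¹) =
      Jki k i hk hik Y := fun k i hk hik =>
    aux_Jki_conj k i hk hik Y v⁻¹ v hu hv (Matrix.mul_nonsing_inv v hvd)
  apply aux_mem _ hn F
  · intro a b hab
    rw [Matrix.mul_apply]
    refine Finset.sum_eq_zero fun c _ => ?_
    by_cases hc : (b : ℕ) < c
    · rw [hu.2 _ _ hc, mul_zero]
    · rw [hvA _ _ (by omega), zero_mul]
  · have h1 := hJ0 n 0 le_rfl hn
    have h2 : Jki n 0 le_rfl hn Y = Y.det := by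
      unfold Jki
      congr 1
      ext r c
      have := r.2
      simp
    rw [h2] at h1
    rw [Matrix.det_mul, Matrix.det_mul, aux_uni_det hv, aux_uni_det hu]
    simpa using h1
  · intro k i hk hik
    rw [hconj, hJY]
    exact hF k i hk hik
  · intro k i hk hik
    rw [hconj]
    exact hJ0 k i hk hik

theorem aux_aeval_mem {σ K L : Type*} [Field K] [Field L] [Algebra K L] (F : Subfield L)
    (hK : ∀ c : K, algebraMap K L c ∈ F) (g : σ → L) (hg : ∀ i, g i ∈ F) (p : MvPolynomial σ K) :
    MvPolynomial.aeval g p ∈ F := by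
  induction p using MvPolynomial.induction_on with
  | C a => simpa using hK a
  | add p q hp hq => rw [map_add]; exact add_mem hp hq
  | mul_X p i hp => rw [map_mul, MvPolynomial.aeval_X]; exact mul_mem hp (hg i)

theorem aux_conj_mem {n : ℕ} {L : Type*} [Field L] (F : Subfield L)
    (v A : Matrix (Fin n) (Fin n) L) (hv : IsUniUpperTriangular v)
    (hvF : ∀ a b, v a b ∈ F) (hA : ∀ a b, A a b ∈ F) (a b : Fin n) :
    (v * A * v⁻¹) a b ∈ F ∧ (v⁻¹ * A * v) a b ∈ F := by
  let v' : Matrix (Fin n) (Fin n) F := Matrix.of fun a b => ⟨v a b, hvF a b⟩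
  have h1 : v = v'.map F.subtype := by ext; rfl
  have h2 : v.adjugate = v'.adjugate.map F.subtype := by
    rw [h1]; exact (RingHom.map_adjugate F.subtype v').symm
  have h3 : ∀ a b, v⁻¹ a b ∈ F := by
    intro a b
    rw [aux_uni_inv_eq hv, h2]
    exact (v'.adjugate a b).2
  have hmul : ∀ B C : Matrix (Fin n) (Fin n) L, (∀ a b, B a b ∈ F) → (∀ a b, C a b ∈ F) →
      ∀ a b, (B * C) a b ∈ F := by
    intro B C hB hC a b
    rw [Matrix.mul_apply]
    exact sum_mem fun c _ => mul_mem (hB _ _) (hC _ _)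
  exact ⟨hmul _ _ (hmul _ _ hvF hA) h3 a b, hmul _ _ (hmul _ _ h3 hA) hvF a b⟩

theorem aux_ev {n : ℕ} {K : Type*} [Field K] {L : Type*} [Field L]
    [Algebra (MvPolynomial (Fin n × Fin n) K) L] [Algebra K L] [IsScalarTower K (MvPolynomial (Fin n × Fin n) K) L]
    (r : MvPolynomial (Fin n × Fin n) K) :
    MvPolynomial.aeval (fun ab : Fin n × Fin n =>
      algebraMap (MvPolynomial (Fin n × Fin n) K) L (MvPolynomial.X ab)) r = algebraMap (MvPolynomial (Fin n × Fin n) K) L r := by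
  have := MvPolynomial.aeval_algebraMap_apply (R := K) L (MvPolynomial.X :
        Fin n × Fin n → MvPolynomial (Fin n × Fin n) K) r
  rw [MvPolynomial.aeval_X_left_apply] at this
  exact this

theorem aux_alg_indep {n : ℕ} {K : Type*} [Field K] {L : Type*} [Field L]
    [Algebra (MvPolynomial (Fin n × Fin n) K) L] [IsFractionRing (MvPolynomial (Fin n × Fin n) K) L]
    [Algebra K L] [IsScalarTower K (MvPolynomial (Fin n × Fin n) K) L]
    (u : Matrix (Fin n) (Fin n) L) (hu : IsUniUpperTriangular u)
    (huF : ∀ F : Subfield L, (∀ k i (hk : k ≤ n) (hik : i < k),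
          algebraMap (MvPolynomial (Fin n × Fin n) K) L (Jki k i hk hik (genMatrix K n)) ∈ F) →
        ∀ a b, (u⁻¹ * (genMatrix K n).map (algebraMap (MvPolynomial (Fin n × Fin n) K) L) * u :
          Matrix (Fin n) (Fin n) L) a b ∈ F) :
    AlgebraicIndependent K
      (fun p : {p : ℕ × ℕ // p.1 ≤ n ∧ p.2 < p.1} =>
        algebraMap (MvPolynomial (Fin n × Fin n) K) L
          (Jki p.1.1 p.1.2 p.2.1 p.2.2 (genMatrix K n))) := by
  let ι := {p : ℕ × ℕ // p.1 ≤ n ∧ p.2 < p.1}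
  let κ := {p : Fin n × Fin n // p.1 < p.2}
  let x : ι ⊕ κ → L := Sum.elim (fun p => algebraMap (MvPolynomial (Fin n × Fin n) K) L
    (Jki p.1.1 p.1.2 p.2.1 p.2.2 (genMatrix K n))) (fun p => u p.1.1 p.1.2)
  let j : ι ⊕ κ → Fin n × Fin n := Sum.elim
    (fun p => (⟨p.1.1 - 1, by have := p.2; omega⟩, ⟨p.1.2, by have := p.2; omega⟩)) (fun p => p.1)
  have hj : Function.Injective j := by
    rintro (⟨⟨k, i⟩, h1, h2⟩ | ⟨⟨a, b⟩, h⟩) (⟨⟨k', i'⟩, h1', h2'⟩ | ⟨⟨a', b'⟩, h'⟩) hjj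
    · simp only [j, Sum.elim_inl, Prod.mk.injEq, Fin.mk.injEq] at hjj h1 h2 h1' h2'
      obtain ⟨h3, rfl⟩ := hjj
      obtain rfl : k = k' := by omega
      rfl
    · simp only [j, Sum.elim_inl, Sum.elim_inr, Prod.mk.injEq] at hjj h1 h2 h'
      obtain ⟨rfl, rfl⟩ := hjj
      rw [Fin.lt_def] at h'
      simp only at h'
      omega
    · simp only [j, Sum.elim_inl, Sum.elim_inr, Prod.mk.injEq] at hjj h1' h2' h
      obtain ⟨rfl, rfl⟩ := hjj
      rw [Fin.lt_def] at h
      simp only at h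
      omega
    · simp only [j, Sum.elim_inr] at hjj
      rw [Sum.inr.injEq]
      exact Subtype.ext hjj
  have hfin : Finite (ι ⊕ κ) := Finite.of_injective j hj
  have htop : ∀ y : L, y ∈ IntermediateField.adjoin K (Set.range x) := by
    let F := (IntermediateField.adjoin K (Set.range x)).toSubfield
    have hxF : ∀ i, x i ∈ F := fun i => IntermediateField.subset_adjoin K _ ⟨i, rfl⟩
    have huF' : ∀ a b, u a b ∈ F := by
      intro a b
      rcases lt_trichotomy a b with h | h | h
      · exact hxF (Sum.inr ⟨(a, b), h⟩)
      · rw [h, hu.1]; exact F.one_mem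
      · rw [hu.2 _ _ h]; exact F.zero_mem
    have hS := huF F (fun k i hk hik => hxF (Sum.inl ⟨(k, i), hk, hik⟩))
    have hud : IsUnit u.det := by rw [aux_uni_det hu]; exact isUnit_one
    have hX : ∀ ab : Fin n × Fin n,
        algebraMap (MvPolynomial (Fin n × Fin n) K) L (MvPolynomial.X ab) ∈ F := by
      intro ab
      have h1 := (aux_conj_mem F u _ hu huF' hS ab.1 ab.2).1
      have h2 : ∀ B : Matrix (Fin n) (Fin n) L, u * (u⁻¹ * B * u) * u⁻¹ = B := by
        intro B
        rw [mul_assoc, mul_assoc (u⁻¹ * B), Matrix.mul_nonsing_inv u hud, mul_one, ← mul_assoc,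
          Matrix.mul_nonsing_inv u hud, one_mul]
      rw [h2] at h1
      exact h1
    have hp : ∀ p, algebraMap (MvPolynomial (Fin n × Fin n) K) L p ∈ F := by
      intro p
      have := aux_aeval_mem F (fun c => (IntermediateField.adjoin K (Set.range x)).algebraMap_mem c)
        (fun ab => algebraMap (MvPolynomial (Fin n × Fin n) K) L (MvPolynomial.X ab)) hX p
      rw [aux_ev] at this
      exact this
    intro y
    obtain ⟨p, q, hq, rfl⟩ := IsFractionRing.div_surjective (A := MvPolynomial (Fin n × Fin n) K) y
    exact F.div_mem (hp p) (hp q)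
  have halg : Algebra.IsAlgebraic (Algebra.adjoin K (Set.range x)) L := by
    constructor
    intro y
    obtain ⟨r, hr, s, hs, rfl⟩ := IntermediateField.mem_adjoin_iff_div.1 (htop y)
    have h1 := isAlgebraic_algebraMap (R := Algebra.adjoin K (Set.range x)) (A := L) ⟨r, hr⟩
    have h2 := isAlgebraic_algebraMap (R := Algebra.adjoin K (Set.range x)) (A := L) ⟨s, hs⟩
    rw [div_eq_mul_inv]
    exact h1.mul h2.inv
  have hXind : AlgebraicIndependent K (fun ab : Fin n × Fin n =>
      algebraMap (MvPolynomial (Fin n × Fin n) K) L (MvPolynomial.X ab)) :=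
    (MvPolynomial.algebraicIndependent_X (Fin n × Fin n) K).map'
      (f := IsScalarTower.toAlgHom K (MvPolynomial (Fin n × Fin n) K) L)
      (IsFractionRing.injective (MvPolynomial (Fin n × Fin n) K) L)
  have hle := hXind.lift_cardinalMk_le_trdeg
  have hbasis := Algebra.IsAlgebraic.isTranscendenceBasis_of_lift_le_trdeg_of_finite K x
    (le_trans (Cardinal.lift_le.2 (Cardinal.mk_le_of_injective hj)) hle)
  exact hbasis.1.comp Sum.inl Sum.inl_injective

theorem aux_rho_gen {n : ℕ} {K : Type*} [Field K] (u : Matrix (Fin n) (Fin n) K) :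
    (genMatrix K n).map (rho u) = (u⁻¹).map MvPolynomial.C * genMatrix K n * u.map MvPolynomial.C := by
  ext a b
  simp [genMatrix, rho]

theorem aux_rho_J {n : ℕ} {K : Type*} [Field K] (u : Matrix (Fin n) (Fin n) K)
    (hu : IsUniUpperTriangular u) (k i : ℕ) (hk : k ≤ n) (hik : i < k) :
    rho u (Jki k i hk hik (genMatrix K n)) = Jki k i hk hik (genMatrix K n) := by
  have h := aux_Jki_map (rho u).toRingHom k i hk hik (genMatrix K n)
  have hud : IsUnit u.det := by rw [aux_uni_det hu]; exact isUnit_one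
  refine Eq.trans h (Eq.trans (congrArg (Jki k i hk hik) (aux_rho_gen u)) ?_)
  apply aux_Jki_conj
  · exact aux_uni_map _ hu
  · exact aux_uni_map _ (aux_uni_inv hu)
  · rw [← Matrix.map_mul, Matrix.nonsing_inv_mul _ hud]
    exact Matrix.map_one _ (map_zero _) (map_one _)

theorem aux_hrho {n : ℕ} {K : Type*} [Field K] {L : Type*} [Field L]
    [Algebra (MvPolynomial (Fin n × Fin n) K) L] [Algebra K L] [IsScalarTower K (MvPolynomial (Fin n × Fin n) K) L]
    (w : Matrix (Fin n) (Fin n) K) (hw : IsUniUpperTriangular w) (r : MvPolynomial (Fin n × Fin n) K) :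
    algebraMap (MvPolynomial (Fin n × Fin n) K) L (rho w r) =
      MvPolynomial.aeval (fun ab : Fin n × Fin n =>
        ((w.map (algebraMap K L))⁻¹ * (genMatrix K n).map (algebraMap (MvPolynomial (Fin n × Fin n) K) L) *
          w.map (algebraMap K L)) ab.1 ab.2) r := by
  have h1 : (w.map (algebraMap K L))⁻¹ = w⁻¹.map (algebraMap K L) := by
    rw [aux_uni_inv_eq hw, aux_uni_inv_eq (aux_uni_map _ hw)]
    exact (RingHom.map_adjugate (algebraMap K L) w).symm
  have h2 : ∀ z : Matrix (Fin n) (Fin n) K, z.map (algebraMap K L) =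
      (z.map (MvPolynomial.C : K →+* MvPolynomial (Fin n × Fin n) K)).map
        (algebraMap (MvPolynomial (Fin n × Fin n) K) L) := by
    intro z
    ext a b
    exact IsScalarTower.algebraMap_apply K (MvPolynomial (Fin n × Fin n) K) L (z a b)
  rw [h1, h2, h2, ← Matrix.map_mul, ← Matrix.map_mul]
  exact (MvPolynomial.aeval_algebraMap_apply (R := K) L _ r).symm

theorem aux_nonvan {n : ℕ} {K L : Type*} [Field K] [Infinite K] [Field L] [Algebra K L]
    (Y S u : Matrix (Fin n) (Fin n) L) (hu : IsUniUpperTriangular u)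
    (hSY : u * S * u⁻¹ = Y) (q : MvPolynomial (Fin n × Fin n) K)
    (hq : MvPolynomial.aeval (fun ab : Fin n × Fin n => Y ab.1 ab.2) q ≠ 0) :
    ∃ w : Matrix (Fin n) (Fin n) K, IsUniUpperTriangular w ∧
      MvPolynomial.aeval (fun ab : Fin n × Fin n =>
        ((w.map (algebraMap K L))⁻¹ * S * w.map (algebraMap K L)) ab.1 ab.2) q ≠ 0 := by
  have hud : IsUnit u.det := by rw [aux_uni_det hu]; exact isUnit_one
  by_contra hcon
  have hcon' : ∀ w : Matrix (Fin n) (Fin n) K, IsUniUpperTriangular w →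
      MvPolynomial.aeval (fun ab : Fin n × Fin n =>
        ((w.map (algebraMap K L))⁻¹ * S * w.map (algebraMap K L)) ab.1 ab.2) q = 0 := by
    intro w hw
    by_contra h
    exact hcon ⟨w, hw, h⟩
  have h1 := aux_density (K := K) S q 0 1 0 (by
    intro w hw
    rw [hcon' w hw, zero_mul, mul_zero]) u⁻¹ (aux_uni_inv hu)
  rw [Matrix.nonsing_inv_nonsing_inv _ hud, hSY, mul_one, mul_zero] at h1
  exact hq h1

theorem aux_core {n : ℕ} {K L : Type*} [Field K] [Infinite K] [Field L] [Algebra K L]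
    (Y S u : Matrix (Fin n) (Fin n) L) (hu : IsUniUpperTriangular u)
    (hS : S = u⁻¹ * Y * u) (p q : MvPolynomial (Fin n × Fin n) K) (P Q : L) (hQ : Q ≠ 0)
    (hq : MvPolynomial.aeval (fun ab : Fin n × Fin n => Y ab.1 ab.2) q ≠ 0)
    (hinv : ∀ w : Matrix (Fin n) (Fin n) K, IsUniUpperTriangular w →
      MvPolynomial.aeval (fun ab : Fin n × Fin n =>
        ((w.map (algebraMap K L))⁻¹ * Y * w.map (algebraMap K L)) ab.1 ab.2) p * Q =
      MvPolynomial.aeval (fun ab : Fin n × Fin n =>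
        ((w.map (algebraMap K L))⁻¹ * Y * w.map (algebraMap K L)) ab.1 ab.2) q * P)
    (F : Subfield L) (hKF : ∀ c : K, algebraMap K L c ∈ F) (hSF : ∀ a b, S a b ∈ F) :
    P / Q ∈ F := by
  have hud : IsUnit u.det := by rw [aux_uni_det hu]; exact isUnit_one
  have hSY : u * S * u⁻¹ = Y := by
    rw [hS, mul_assoc, mul_assoc (u⁻¹ * Y), Matrix.mul_nonsing_inv u hud, mul_one,
      ← mul_assoc, Matrix.mul_nonsing_inv u hud, one_mul]
  obtain ⟨w, hw, hwq⟩ := aux_nonvan (K := K) Y S u hu hSY q hq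
  have hWF : ∀ a b, w.map (algebraMap K L) a b ∈ F := fun a b => hKF (w a b)
  have hWu : IsUniUpperTriangular (w.map (algebraMap K L)) := aux_uni_map _ hw
  generalize w.map (algebraMap K L) = W at hwq hWF hWu
  have h1 := aux_density (K := K) Y p q Q P hinv (u * W) (aux_uni_mul hu hWu)
  have h2 : (u * W)⁻¹ * Y * (u * W) = W⁻¹ * S * W := by
    rw [Matrix.mul_inv_rev, hS, ← mul_assoc, ← mul_assoc, ← mul_assoc]
  rw [h2] at h1
  have hmem : ∀ r : MvPolynomial (Fin n × Fin n) K,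
      MvPolynomial.aeval (fun ab : Fin n × Fin n => (W⁻¹ * S * W) ab.1 ab.2) r ∈ F :=
    fun r => aux_aeval_mem (K := K) F hKF (fun ab : Fin n × Fin n => (W⁻¹ * S * W) ab.1 ab.2)
      (fun ab => (aux_conj_mem F W S hWu hWF hSF ab.1 ab.2).2) r
  have h3 : P / Q = MvPolynomial.aeval (fun ab : Fin n × Fin n => (W⁻¹ * S * W) ab.1 ab.2) p /
      MvPolynomial.aeval (fun ab : Fin n × Fin n => (W⁻¹ * S * W) ab.1 ab.2) q := by
    exact (div_eq_div_iff hQ hwq).2 ((mul_comm _ _).trans h1.symm)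
  rw [h3]
  exact div_mem (hmem p) (hmem q)

theorem aux_incl {n : ℕ} {K : Type*} [Field K] [Infinite K] {L : Type*} [Field L]
    [Algebra (MvPolynomial (Fin n × Fin n) K) L] [IsFractionRing (MvPolynomial (Fin n × Fin n) K) L]
    [Algebra K L] [IsScalarTower K (MvPolynomial (Fin n × Fin n) K) L]
    (u : Matrix (Fin n) (Fin n) L) (hu : IsUniUpperTriangular u)
    (huF : ∀ F : Subfield L, (∀ k i (hk : k ≤ n) (hik : i < k),
          algebraMap (MvPolynomial (Fin n × Fin n) K) L (Jki k i hk hik (genMatrix K n)) ∈ F) →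
        ∀ a b, (u⁻¹ * (genMatrix K n).map (algebraMap (MvPolynomial (Fin n × Fin n) K) L) * u :
          Matrix (Fin n) (Fin n) L) a b ∈ F)
    (ρ' : Matrix (Fin n) (Fin n) K → (L →+* L))
    (hρ' : ∀ u : Matrix (Fin n) (Fin n) K, IsUniUpperTriangular u →
      ∀ p : MvPolynomial (Fin n × Fin n) K, ρ' u (algebraMap (MvPolynomial (Fin n × Fin n) K) L p) = algebraMap (MvPolynomial (Fin n × Fin n) K) L (rho u p))
    (F : Subfield L) (hKF : ∀ c : K, algebraMap K L c ∈ F)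
    (hJF : ∀ k i (hk : k ≤ n) (hik : i < k),
          algebraMap (MvPolynomial (Fin n × Fin n) K) L (Jki k i hk hik (genMatrix K n)) ∈ F) (f : L)
    (hf : ∀ u : Matrix (Fin n) (Fin n) K, IsUniUpperTriangular u → ρ' u f = f) : f ∈ F := by
  obtain ⟨p, q, hq, rfl⟩ := IsFractionRing.div_surjective (A := MvPolynomial (Fin n × Fin n) K) f
  have hq0 : algebraMap (MvPolynomial (Fin n × Fin n) K) L q ≠ 0 := by
    intro h
    exact nonZeroDivisors.ne_zero hq
      ((IsFractionRing.injective (MvPolynomial (Fin n × Fin n) K) L) (h.trans (map_zero _).symm))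
  have hinv : ∀ w : Matrix (Fin n) (Fin n) K, IsUniUpperTriangular w →
      algebraMap (MvPolynomial (Fin n × Fin n) K) L (rho w p) *
        algebraMap (MvPolynomial (Fin n × Fin n) K) L q =
      algebraMap (MvPolynomial (Fin n × Fin n) K) L (rho w q) *
        algebraMap (MvPolynomial (Fin n × Fin n) K) L p := by
    intro w hw
    have h1 := hf w hw
    have h2 : algebraMap (MvPolynomial (Fin n × Fin n) K) L (rho w q) ≠ 0 := by
      rw [← hρ' w hw]
      exact (map_ne_zero (ρ' w)).2 hq0
    rw [map_div₀, hρ' w hw, hρ' w hw, div_eq_div_iff h2 hq0] at h1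
    rw [h1, mul_comm]
  refine aux_core (K := K) _ _ u hu rfl p q _ _ hq0 ?_ ?_ F hKF (huF F hJF)
  · exact fun h => hq0 ((aux_ev q).symm.trans h)
  · intro w hw
    exact (congrArg₂ (· * ·) (aux_hrho w hw p) rfl).symm.trans
      ((hinv w hw).trans (congrArg₂ (· * ·) (aux_hrho w hw q) rfl))

theorem aux_incl2 {n : ℕ} {K : Type*} [Field K] {L : Type*} [Field L]
    [Algebra (MvPolynomial (Fin n × Fin n) K) L] [Algebra K L] [IsScalarTower K (MvPolynomial (Fin n × Fin n) K) L]
    (ρ' : Matrix (Fin n) (Fin n) K → (L →+* L))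
    (hρ' : ∀ u : Matrix (Fin n) (Fin n) K, IsUniUpperTriangular u →
      ∀ p : MvPolynomial (Fin n × Fin n) K, ρ' u (algebraMap (MvPolynomial (Fin n × Fin n) K) L p) = algebraMap (MvPolynomial (Fin n × Fin n) K) L (rho u p))
    (f : L) (hf : f ∈ Subfield.closure (Set.range (algebraMap K L) ∪
          {g | ∃ (k i : ℕ) (hk : k ≤ n) (hik : i < k),
            g = algebraMap (MvPolynomial (Fin n × Fin n) K) L (Jki k i hk hik (genMatrix K n))}))
    (u : Matrix (Fin n) (Fin n) K) (hu : IsUniUpperTriangular u) : ρ' u f = f := by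
  have hle : Subfield.closure (Set.range (algebraMap K L) ∪
          {g | ∃ (k i : ℕ) (hk : k ≤ n) (hik : i < k),
            g = algebraMap (MvPolynomial (Fin n × Fin n) K) L (Jki k i hk hik (genMatrix K n))})
      ≤ (ρ' u).eqLocusField (RingHom.id L) := by
    rw [Subfield.closure_le]
    rintro g (⟨c, rfl⟩ | ⟨k, i, hk, hik, rfl⟩)
    · change ρ' u _ = _
      rw [IsScalarTower.algebraMap_apply K (MvPolynomial (Fin n × Fin n) K) L, hρ' u hu]
      rw [AlgHom.commutes]
      rfl
    · change ρ' u _ = _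
      rw [hρ' u hu, aux_rho_J u hu]
      rfl
  exact hle hf

/-- The field of `U`-invariants `K(M)^U` of the adjoint representation of
`GL(n,K)` is a purely transcendental extension of `K` of transcendence degree
`n(n+1)/2`: the polynomials `J_{k,i}`, `1 ≤ k ≤ n`, `0 ≤ i ≤ k-1`, form an
algebraically independent family that generates `K(M)^U` over `K` as a
field.  Here the action of `U` on `K(M)`, the fraction field of `K[x]`, is by
the (unique) extension `ρ'` of `ρ` to the fraction field. -/
theorem field_of_U_invariants_purely_transcendental {n : ℕ} {K : Type*}
    [Field K] [CharZero K] (hn : 1 ≤ n)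
    (ρ' : Matrix (Fin n) (Fin n) K →
      (FractionRing (MvPolynomial (Fin n × Fin n) K) →+*
        FractionRing (MvPolynomial (Fin n × Fin n) K)))
    (hρ' : ∀ u : Matrix (Fin n) (Fin n) K, IsUniUpperTriangular u →
      ∀ p : MvPolynomial (Fin n × Fin n) K,
        ρ' u (algebraMap _ _ p) = algebraMap _ _ (rho u p)) :
    AlgebraicIndependent K
      (fun p : {p : ℕ × ℕ // p.1 ≤ n ∧ p.2 < p.1} =>
        algebraMap (MvPolynomial (Fin n × Fin n) K)
          (FractionRing (MvPolynomial (Fin n × Fin n) K))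
          (Jki p.1.1 p.1.2 p.2.1 p.2.2 (genMatrix K n))) ∧
    {f : FractionRing (MvPolynomial (Fin n × Fin n) K) |
        ∀ u : Matrix (Fin n) (Fin n) K, IsUniUpperTriangular u → ρ' u f = f} =
      (Subfield.closure
        (Set.range (algebraMap K (FractionRing (MvPolynomial (Fin n × Fin n) K))) ∪
          {g | ∃ (k i : ℕ) (hk : k ≤ n) (hik : i < k),
            g = algebraMap (MvPolynomial (Fin n × Fin n) K) _
              (Jki k i hk hik (genMatrix K n))}) :
        Set (FractionRing (MvPolynomial (Fin n × Fin n) K))) := by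
  obtain ⟨u, hu, huF⟩ := aux_section (K := K) hn
  refine ⟨aux_alg_indep u hu huF, Set.Subset.antisymm ?_ ?_⟩
  · intro f hf
    exact aux_incl u hu huF ρ' hρ' _ (fun c => Subfield.subset_closure (Or.inl ⟨c, rfl⟩))
      (fun k i hk hik => Subfield.subset_closure (Or.inr ⟨k, i, hk, hik, rfl⟩)) f hf
  · intro f hf u hu
    exact aux_incl2 ρ' hρ' f hf u hu
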